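/- The class of ribbonless graphs is stable under marginalisation and conditioning: for every ribbonless graph G with node set V and all disjoint subsets M, C of V, there exists a ribbonless graph H with node set V∖(M∪C) such that J_m(H) = α(J_m(G);M,C). -/

import Mathlib

/-!
Stable mixed graphs: mixed graphs with arrows, arcs and lines; ribbonless,
summary and ancestral graphs; the generating maps α_RG, α_SG, α_AG;
m-connecting paths, m-separation and induced independence models.
-/

namespace StableMixedGraphs

/-- A mixed graph on node type `V`: a node set together with three edge
relations: arrows (`arrow i j` means an arrow from `i` to `j`), arcs
(two-headed, symmetric) and lines (undirected, symmetric). -/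
structure MixedGraph (V : Type) where
  nodes : Set V
  arrow : V → V → Prop
  arc : V → V → Prop
  line : V → V → Prop

namespace MixedGraph

variable {V W : Type}

/-- Wellformedness: arcs and lines are symmetric relations and all edges join
nodes of the graph. -/
def Wf (G : MixedGraph V) : Prop :=
  (∀ i j, G.arc i j → G.arc j i) ∧
  (∀ i j, G.line i j → G.line j i) ∧
  (∀ i j, G.arrow i j ∨ G.arc i j ∨ G.line i j → i ∈ G.nodes ∧ j ∈ G.nodes)

/-- No loops of any of the three kinds. -/
def Loopless (G : MixedGraph V) : Prop :=
  ∀ i, ¬ G.arrow i i ∧ ¬ G.arc i i ∧ ¬ G.line i i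

/-- A loopless mixed graph with a finite node set. -/
def IsLMG (G : MixedGraph V) : Prop := G.Wf ∧ G.Loopless ∧ G.nodes.Finite

/-- `G.anc i j` : `i` is an ancestor of `j`, i.e. there is a
direction-preserving path from `i` to `j`. -/
def anc (G : MixedGraph V) (i j : V) : Prop := Relation.TransGen G.arrow i j

/-- The set of ancestors of nodes of `C`. -/
def anSet (G : MixedGraph V) (C : Set V) : Set V := {a | ∃ c ∈ C, G.anc a c}

/-- `i` lies on a direction-preserving cycle. -/
def OnDPCycle (G : MixedGraph V) (i : V) : Prop := G.anc i i

/-- `i` is an endpoint of a line. -/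
def LineEndpoint (G : MixedGraph V) (i : V) : Prop := ∃ j, G.line i j

/-- Condition (2) of a ribbon: `i` or a descendant of `i` is an endpoint of a
line or lies on a direction-preserving cycle. -/
def RibbonTail (G : MixedGraph V) (i : V) : Prop :=
  ∃ d, (d = i ∨ G.anc i d) ∧ (G.LineEndpoint d ∨ G.OnDPCycle d)

/-- `G` contains a ribbon: a collider V-configuration `⟨h,i,j⟩` with no
endpoint-identical edge between `h` and `j`, whose inner node `i` (or a
descendant of it) is an endpoint of a line or on a direction-preserving
cycle. -/
def HasRibbon (G : MixedGraph V) : Prop :=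
  ∃ h i j, h ≠ i ∧ i ≠ j ∧ h ≠ j ∧ G.RibbonTail i ∧
    ((G.arc h i ∧ G.arc i j ∧ ¬ G.arc h j) ∨
     (G.arrow h i ∧ G.arrow j i ∧ ¬ G.line h j) ∨
     (G.arrow h i ∧ G.arc i j ∧ ¬ G.arrow h j))

/-- A ribbonless graph: a loopless mixed graph with no ribbon. -/
def IsRG (G : MixedGraph V) : Prop := G.IsLMG ∧ ¬ G.HasRibbon

/-- A directed acyclic graph: only arrows, no direction-preserving cycle. -/
def IsDAG (G : MixedGraph V) : Prop :=
  G.IsLMG ∧ (∀ i j, ¬ G.arc i j) ∧ (∀ i j, ¬ G.line i j) ∧ ∀ i, ¬ G.anc i i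

/-- A summary graph: a loopless mixed graph with no arrowhead pointing to an
endpoint of a line and no direction-preserving cycle. -/
def IsSG (G : MixedGraph V) : Prop :=
  G.IsLMG ∧ (∀ i, G.LineEndpoint i → ∀ k, ¬ G.arrow k i ∧ ¬ G.arc k i) ∧
    ∀ i, ¬ G.anc i i

/-- A simple mixed graph: no loops and no multiple edges. -/
def Simple (G : MixedGraph V) : Prop :=
  G.Loopless ∧ ∀ i j,
    (G.arrow i j → ¬ G.arrow j i ∧ ¬ G.arc i j ∧ ¬ G.line i j) ∧
    (G.arc i j → ¬ G.line i j)

/-- An ancestral graph: a simple mixed graph such that no node is an ancestor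
of one of its parents or spouses, and a node with a neighbour has neither
parents nor spouses. -/
def IsAG (G : MixedGraph V) : Prop :=
  G.Wf ∧ G.Simple ∧ G.nodes.Finite ∧
  (∀ i j, G.arrow j i ∨ G.arc j i → ¬ G.anc i j) ∧
  (∀ i, G.LineEndpoint i → ∀ k, ¬ G.arrow k i ∧ ¬ G.arc k i)

/-- An undirected graph: only lines. -/
def IsUG (G : MixedGraph V) : Prop :=
  G.IsLMG ∧ (∀ i j, ¬ G.arrow i j) ∧ ∀ i j, ¬ G.arc i j

/-- A bidirected graph: only arcs. -/
def IsBG (G : MixedGraph V) : Prop :=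
  G.IsLMG ∧ (∀ i j, ¬ G.arrow i j) ∧ ∀ i j, ¬ G.line i j

/-- Image of a mixed graph under a map of node types. -/
def map (f : V → W) (G : MixedGraph V) : MixedGraph W where
  nodes := f '' G.nodes
  arrow a b := ∃ i j, G.arrow i j ∧ f i = a ∧ f j = b
  arc a b := ∃ i j, G.arc i j ∧ f i = a ∧ f j = b
  line a b := ∃ i j, G.line i j ∧ f i = a ∧ f j = b

end MixedGraph

/-! ### The closure generating new edges (Table 1 of the RG-generating
algorithm), for given marginalisation set `M` and collider set
`S = C ∪ an(C)`.  For every V-configuration whose inner node is a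
non-collider in `M` (rows 1–7) or a collider in `S` (rows 8–10) the
endpoint-identical edge between the endpoints is generated, repeatedly
until closure. -/

mutual
  /-- Generated arrows (`GenArrow H M S j i`: arrow from `j` to `i`). -/
  inductive GenArrow {V : Type} (H : MixedGraph V) (M S : Set V) : V → V → Prop
    | base {i j : V} : H.arrow i j → GenArrow H M S i j
    | row1 {i j m : V} : m ∈ M → j ≠ i →
        GenArrow H M S j m → GenArrow H M S m i → GenArrow H M S j i
    | row2 {i j m : V} : m ∈ M → j ≠ i →
        GenLine H M S j m → GenArrow H M S m i → GenArrow H M S j i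
    | row3 {i j m : V} : m ∈ M → j ≠ i →
        GenLine H M S j m → GenArc H M S m i → GenArrow H M S j i
    | row8 {i j s : V} : s ∈ S → j ≠ i →
        GenArrow H M S j s → GenArc H M S s i → GenArrow H M S j i

  /-- Generated arcs. -/
  inductive GenArc {V : Type} (H : MixedGraph V) (M S : Set V) : V → V → Prop
    | base {i j : V} : H.arc i j → GenArc H M S i j
    | symm {i j : V} : GenArc H M S i j → GenArc H M S j i
    | row4 {i j m : V} : m ∈ M → i ≠ j →
        GenArrow H M S m i → GenArrow H M S m j → GenArc H M S i j
    | row5 {i j m : V} : m ∈ M → i ≠ j →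
        GenArrow H M S m i → GenArc H M S m j → GenArc H M S i j
    | row9 {i j s : V} : s ∈ S → i ≠ j →
        GenArc H M S i s → GenArc H M S s j → GenArc H M S i j

  /-- Generated lines. -/
  inductive GenLine {V : Type} (H : MixedGraph V) (M S : Set V) : V → V → Prop
    | base {i j : V} : H.line i j → GenLine H M S i j
    | symm {i j : V} : GenLine H M S i j → GenLine H M S j i
    | row6 {i j m : V} : m ∈ M → i ≠ j →
        GenLine H M S i m → GenArrow H M S j m → GenLine H M S i j
    | row7 {i j m : V} : m ∈ M → i ≠ j →
        GenLine H M S i m → GenLine H M S m j → GenLine H M S i j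
    | row10 {i j s : V} : s ∈ S → i ≠ j →
        GenArrow H M S i s → GenArrow H M S j s → GenLine H M S i j
end

variable {V : Type}

/-- The RG-generating map `α_RG(H;M,C)`: generate all edges of the closure
and delete the nodes of `M ∪ C`. -/
def alphaRG (H : MixedGraph V) (M C : Set V) : MixedGraph V where
  nodes := H.nodes \ (M ∪ C)
  arrow i j := i ∈ H.nodes \ (M ∪ C) ∧ j ∈ H.nodes \ (M ∪ C) ∧
    GenArrow H M (C ∪ H.anSet C) i j
  arc i j := i ∈ H.nodes \ (M ∪ C) ∧ j ∈ H.nodes \ (M ∪ C) ∧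
    GenArc H M (C ∪ H.anSet C) i j
  line i j := i ∈ H.nodes \ (M ∪ C) ∧ j ∈ H.nodes \ (M ∪ C) ∧
    GenLine H M (C ∪ H.anSet C) i j

/-- The arrowhead-removal operation `α_RG.SG(K;A)`: every arrowhead pointing
at a node of `A` is removed (an arrow at such a node becomes a line, an arc
becomes an arrow, an arc with both endpoints in `A` becomes a line),
repeatedly until closure. -/
def deheadAt (K : MixedGraph V) (A : Set V) : MixedGraph V where
  nodes := K.nodes
  arrow j i := i ∉ A ∧ (K.arrow j i ∨ (K.arc j i ∧ j ∈ A))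
  arc i j := K.arc i j ∧ i ∉ A ∧ j ∉ A
  line i j := K.line i j ∨ (K.arrow j i ∧ i ∈ A) ∨ (K.arrow i j ∧ j ∈ A) ∨
    (K.arc i j ∧ i ∈ A ∧ j ∈ A)

/-- The SG-generating map `α_SG(H;M,C)`: mark the nodes of `an(C)`, apply the
RG-generating construction, then remove all arrowheads pointing at marked
nodes. -/
def alphaSG (H : MixedGraph V) (M C : Set V) : MixedGraph V :=
  deheadAt (alphaRG H M C) (H.anSet C)

/-! ### Step 2 of the AG-generating algorithm: for every V-configuration
`j → k ↔ i` or `j ↔ k ↔ i` with `k ∈ an(i)` (in the current graph) generate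
an arrow from `j` to `i`, respectively an arc between `j` and `i`, until
closure. -/

mutual
  inductive AG2Arrow {V : Type} (K : MixedGraph V) : V → V → Prop
    | base {i j : V} : K.arrow j i → AG2Arrow K j i
    | gen {i j k : V} : j ≠ i → AG2Arrow K j k → AG2Arc K k i →
        AG2Anc K k i → AG2Arrow K j i

  inductive AG2Arc {V : Type} (K : MixedGraph V) : V → V → Prop
    | base {i j : V} : K.arc i j → AG2Arc K i j
    | symm {i j : V} : AG2Arc K i j → AG2Arc K j i
    | gen {i j k : V} : j ≠ i → AG2Arc K j k → AG2Arc K k i →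
        AG2Anc K k i → AG2Arc K j i

  /-- The ancestor relation of the graph being generated in step 2. -/
  inductive AG2Anc {V : Type} (K : MixedGraph V) : V → V → Prop
    | single {i j : V} : AG2Arrow K i j → AG2Anc K i j
    | tail {i k j : V} : AG2Arrow K i k → AG2Anc K k j → AG2Anc K i j
end

/-- The graph after step 2 of the AG-generating algorithm. -/
def ag2 (K : MixedGraph V) : MixedGraph V where
  nodes := K.nodes
  arrow := AG2Arrow K
  arc := AG2Arc K
  line := K.line

/-! ### Step 3 of the AG-generating algorithm: repeatedly replace every arc
between `j` and `i` with `j ∈ an(i)` (in the current graph) by an arrow from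
`j` to `i`. -/

mutual
  inductive AG3Arrow {V : Type} (K : MixedGraph V) : V → V → Prop
    | base {i j : V} : K.arrow j i → AG3Arrow K j i
    | conv {i j : V} : K.arc j i → AG3Anc K j i → AG3Arrow K j i

  /-- The ancestor relation of the graph being generated in step 3. -/
  inductive AG3Anc {V : Type} (K : MixedGraph V) : V → V → Prop
    | single {i j : V} : AG3Arrow K i j → AG3Anc K i j
    | tail {i k j : V} : AG3Arrow K i k → AG3Anc K k j → AG3Anc K i j
end

/-- Steps 2 and 3 of the AG-generating algorithm, applied to a summary
graph: `α_SG.AG`. -/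
def alphaSGAG (K : MixedGraph V) : MixedGraph V :=
  let K2 := ag2 K
  { nodes := K.nodes
    arrow := AG3Arrow K2
    arc := fun i j => K2.arc i j ∧ ¬ AG3Anc K2 i j ∧ ¬ AG3Anc K2 j i
    line := K.line }

/-- The AG-generating map `α_AG(H;M,C)`. -/
def alphaAG (H : MixedGraph V) (M C : Set V) : MixedGraph V :=
  alphaSGAG (alphaSG H M C)

/-! ### Paths, m-connection and m-separation. -/

/-- A step of a walk: it goes from `src` to `tgt` along an edge which has an
arrowhead at `src` iff `hs = true` and an arrowhead at `tgt` iff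
`ht = true` (so `hs = ht = false` is a line, `hs = ht = true` an arc, and
exactly one head an arrow in the corresponding direction). -/
structure Step (V : Type) where
  src : V
  tgt : V
  hs : Bool
  ht : Bool

/-- The edge of a step is present in `G`. -/
def Step.valid (G : MixedGraph V) (s : Step V) : Prop :=
  match s.hs, s.ht with
  | false, false => G.line s.src s.tgt
  | false, true  => G.arrow s.src s.tgt
  | true,  false => G.arrow s.tgt s.src
  | true,  true  => G.arc s.src s.tgt

/-- `w` is a path from `i` to `j` in `G`: a nonempty chained list of valid
steps with no repeated nodes. -/
def IsPath (G : MixedGraph V) (i j : V) (w : List (Step V)) : Prop :=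
  w ≠ [] ∧ (∀ s ∈ w, s.valid G) ∧ List.Chain' (fun a b => a.tgt = b.src) w ∧
    w.head?.map Step.src = some i ∧ w.getLast?.map Step.tgt = some j ∧
    (i :: w.map Step.tgt).Nodup

/-- The path `w` is m-connecting given `M` and `C`: every inner collider node
is in `C ∪ an(C)` and every inner non-collider node is in `M`. -/
def MConnPath (G : MixedGraph V) (M C : Set V) (w : List (Step V)) : Prop :=
  List.Chain'
    (fun a b =>
      (a.ht = true ∧ b.hs = true → a.tgt ∈ C ∪ G.anSet C) ∧
      (¬ (a.ht = true ∧ b.hs = true) → a.tgt ∈ M)) w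

/-- `A ⊥_m B | C` in `G` : there is no m-connecting path between `A` and `B`
given `C` (with `M` the remaining nodes). -/
def MSep (G : MixedGraph V) (A B C : Set V) : Prop :=
  ∀ i ∈ A, ∀ j ∈ B, ∀ w : List (Step V),
    IsPath G i j w → ¬ MConnPath G (G.nodes \ (A ∪ B ∪ C)) C w

/-- The independence model induced by `G` via m-separation: the set of
triples `⟨A,B|C⟩` of pairwise disjoint subsets of the nodes with
`A ⊥_m B | C`. -/
def Jm (G : MixedGraph V) : Set (Set V × Set V × Set V) :=
  {t | t.1 ⊆ G.nodes ∧ t.2.1 ⊆ G.nodes ∧ t.2.2 ⊆ G.nodes ∧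
    Disjoint t.1 t.2.1 ∧ Disjoint t.1 t.2.2 ∧ Disjoint t.2.1 t.2.2 ∧
    MSep G t.1 t.2.1 t.2.2}

/-- The independence model after marginalisation over `M` and conditioning on
`C` : `α(J;M,C)`. -/
def alphaIM (J : Set (Set V × Set V × Set V)) (M C : Set V) :
    Set (Set V × Set V × Set V) :=
  {t | (t.1, t.2.1, t.2.2 ∪ C) ∈ J ∧ (t.1 ∪ t.2.1 ∪ t.2.2) ∩ (M ∪ C) = ∅}

/-! ### Walks -/

/-- The edge between `x` and `y` with arrowhead marks `a` at `x` and `b` at `y` is in `G`. -/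
def Edge (G : MixedGraph V) (a : Bool) (x y : V) (b : Bool) : Prop :=
  Step.valid G ⟨x, y, a, b⟩

/-- Two edges meeting at `y` with marks `b` and `c` may be joined: `y` lies in `S` if it is
a collider and in `M` otherwise. -/
def Join (M S : Set V) (b : Bool) (y : V) (c : Bool) : Prop :=
  (b = true ∧ c = true → y ∈ S) ∧ (¬ (b = true ∧ c = true) → y ∈ M)

/-- A walk with inner colliders in `S` and inner non-colliders in `M`, together with the
marks at its two endpoints. -/
inductive Walk (G : MixedGraph V) (M S : Set V) : Bool → V → V → Bool → Prop
  | single {a b : Bool} {x y : V} : Edge G a x y b → Walk G M S a x y b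
  | snoc {a b c d : Bool} {x y z : V} : Walk G M S a x y b → Edge G c y z d →
      Join M S b y c → Walk G M S a x z d

theorem Edge.rev {G : MixedGraph V} (hG : G.Wf) {a b : Bool} {x y : V} (h : Edge G a x y b) :
    Edge G b y x a := by
  cases a <;> cases b
  · exact hG.2.1 _ _ h
  · exact h
  · exact h
  · exact hG.1 _ _ h

theorem Edge.mem_nodes {G : MixedGraph V} (hG : G.Wf) {a b : Bool} {x y : V}
    (h : Edge G a x y b) : x ∈ G.nodes ∧ y ∈ G.nodes := by
  cases a <;> cases b
  · exact hG.2.2 _ _ (Or.inr (Or.inr h))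
  · exact hG.2.2 _ _ (Or.inl h)
  · exact (hG.2.2 _ _ (Or.inl h)).symm
  · exact hG.2.2 _ _ (Or.inr (Or.inl h))

theorem Edge.ne {G : MixedGraph V} (hG : G.Loopless) {a b : Bool} {x y : V}
    (h : Edge G a x y b) : x ≠ y := by
  rintro rfl
  cases a <;> cases b
  · exact (hG x).2.2 h
  · exact (hG x).1 h
  · exact (hG x).1 h
  · exact (hG x).2.1 h

theorem Join.symm {M S : Set V} {b c : Bool} {y : V} (h : Join M S b y c) : Join M S c y b :=
  ⟨fun h' => h.1 h'.symm, fun h' => h.2 fun h'' => h' h''.symm⟩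

theorem Join.mono {M M' S S' : Set V} (hM : M ⊆ M') (hS : S ⊆ S') {b c : Bool} {y : V}
    (h : Join M S b y c) : Join M' S' b y c :=
  ⟨fun h' => hS (h.1 h'), fun h' => hM (h.2 h')⟩

namespace Walk

variable {G : MixedGraph V} {M M' S S' : Set V} {a b c d : Bool} {x y z : V}

theorem mono (hM : M ⊆ M') (hS : S ⊆ S') (h : Walk G M S a x y b) : Walk G M' S' a x y b := by
  induction h with
  | single h => exact .single h
  | snoc _ h hj ih => exact .snoc ih h (hj.mono hM hS)

theorem trans (h : Walk G M S a x y b) (h' : Walk G M S c y z d) (hj : Join M S b y c) :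
    Walk G M S a x z d := by
  induction h' with
  | single e => exact .snoc h e hj
  | snoc _ e hj' ih => exact .snoc (ih h hj) e hj'

theorem rev (hG : G.Wf) (h : Walk G M S a x y b) : Walk G M S b y x a := by
  induction h with
  | single e => exact .single (e.rev hG)
  | snoc _ e hj ih => exact (Walk.single (e.rev hG)).trans ih hj.symm

end Walk

/-- The nodes that are, or have a descendant that is, an endpoint of a line or on a
direction-preserving cycle, together with `C` and the ancestors of `C`. -/
def tailSet (G : MixedGraph V) (C : Set V) : Set V :=
  {x | x ∈ C ∪ G.anSet C ∨ G.RibbonTail x}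

theorem anSet_closed {G : MixedGraph V} {C : Set V} {x y : V} (h : G.anc x y)
    (hy : y ∈ C ∪ G.anSet C) : x ∈ C ∪ G.anSet C := by
  rcases hy with hy | ⟨c, hc, hyc⟩
  · exact Or.inr ⟨y, hy, h⟩
  · exact Or.inr ⟨c, hc, h.trans hyc⟩

theorem tailSet_closed {G : MixedGraph V} {C : Set V} {x y : V} (h : G.anc x y)
    (hy : y ∈ tailSet G C) : x ∈ tailSet G C := by
  rcases hy with hy | ⟨d, hd, hd'⟩
  · exact Or.inl (anSet_closed h hy)
  · refine Or.inr ⟨d, Or.inr ?_, hd'⟩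
    rcases hd with rfl | hd
    · exact h
    · exact h.trans hd

theorem tailSet_mono {G : MixedGraph V} {C C' : Set V} (h : C ⊆ C') :
    tailSet G C ⊆ tailSet G C' := by
  rintro x ((hx | ⟨c, hc, hxc⟩) | hx)
  · exact Or.inl (Or.inl (h hx))
  · exact Or.inl (Or.inr ⟨c, h hc, hxc⟩)
  · exact Or.inr hx

theorem mem_tailSet_of_line {G : MixedGraph V} {C : Set V} {x y : V} (h : G.line x y) :
    x ∈ tailSet G C :=
  Or.inr ⟨x, Or.inl rfl, Or.inl ⟨y, h⟩⟩

theorem mem_tailSet_of_cycle {G : MixedGraph V} {C : Set V} {x : V} (h : G.anc x x) :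
    x ∈ tailSet G C :=
  Or.inr ⟨x, Or.inl rfl, Or.inr h⟩

/-- A walk leaving `x` through a tail either certifies `x ∈ tailSet G C` or is
direction-preserving. -/
theorem Walk.tail {G : MixedGraph V} {M C : Set V} {a b : Bool} {x y : V}
    (h : Walk G M (tailSet G C) a x y b) (ha : a = false) :
    x ∈ tailSet G C ∨ (b = true ∧ G.anc x y) := by
  induction h with
  | @single b x y e =>
    subst ha
    cases b
    · exact Or.inl (mem_tailSet_of_line e)
    · exact Or.inr ⟨rfl, .single e⟩
  | @snoc b c d x y z _ e hj ih =>
    rcases ih with hx | ⟨rfl, hxy⟩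
    · exact Or.inl hx
    · cases c
      · cases d
        · exact Or.inl (tailSet_closed hxy (mem_tailSet_of_line e))
        · exact Or.inr ⟨rfl, hxy.tail e⟩
      · exact Or.inl (tailSet_closed hxy (hj.1 ⟨rfl, rfl⟩))

theorem Walk.mem_of_tail_loop {G : MixedGraph V} {M C : Set V} {b : Bool} {x : V}
    (h : Walk G M (tailSet G C) false x x b) : x ∈ tailSet G C :=
  (h.tail rfl).elim id fun h' => mem_tailSet_of_cycle h'.2

/-- Removing a loop at `x` from a walk keeps the two remaining edges joinable at `x`. -/
theorem Join.of_loop {G : MixedGraph V} {M C : Set V} {a p q b : Bool} {x : V}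
    (h : Walk G M (tailSet G C) p x x q) (h₁ : Join M (tailSet G C) a x p)
    (h₂ : Join M (tailSet G C) q x b) : Join M (tailSet G C) a x b := by
  constructor
  · rintro ⟨rfl, rfl⟩
    cases p
    · exact h.mem_of_tail_loop
    · exact h₁.1 ⟨rfl, rfl⟩
  · intro hab
    cases a
    · exact h₁.2 (by simp)
    · cases b
      · exact h₂.2 (by simp)
      · exact absurd ⟨rfl, rfl⟩ hab

/-! ### Walks as lists of steps -/

/-- Consecutive steps of a list that represents a walk. -/
def Linked (M S : Set V) (s t : Step V) : Prop :=
  s.tgt = t.src ∧ Join M S s.ht s.tgt t.hs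

/-- The list `w` represents a walk from `i` to `j` with inner colliders in `S` and inner
non-colliders in `M`. -/
def IsWalk (G : MixedGraph V) (M S : Set V) (i j : V) (w : List (Step V)) : Prop :=
  (∀ s ∈ w, s.valid G) ∧ w.IsChain (Linked M S) ∧
    w.head?.map Step.src = some i ∧ w.getLast?.map Step.tgt = some j

theorem Walk.exists_list {G : MixedGraph V} {M S : Set V} {a b : Bool} {x y : V}
    (h : Walk G M S a x y b) :
    ∃ w, IsWalk G M S x y w ∧ w.getLast?.map Step.ht = some b := by
  induction h with
  | @single b x y e =>
    exact ⟨[⟨x, y, a, b⟩], ⟨fun s hs => List.mem_singleton.1 hs ▸ e, by simp, rfl, rfl⟩, rfl⟩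
  | @snoc b c d x y z _ e hj ih =>
    obtain ⟨w, ⟨hv, hc, hh, hl⟩, hb⟩ := ih
    refine ⟨w ++ [⟨y, z, c, d⟩], ⟨?_, ?_, ?_, by simp⟩, by simp⟩
    · intro s hs
      rcases List.mem_append.1 hs with hs | hs
      · exact hv s hs
      · rw [List.mem_singleton.1 hs]
        exact e
    · refine List.isChain_append.2 ⟨hc, by simp, ?_⟩
      intro s hs t ht
      simp only [Option.mem_def] at hs
      simp only [List.head?_cons, Option.mem_def, Option.some.injEq] at ht
      subst ht
      simp only [hs, Option.map_some, Option.some.injEq] at hl hb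
      exact ⟨hl, by simpa [hl, hb] using hj⟩
    · cases w with
      | nil => simp at hh
      | cons s w => simpa using hh

theorem Walk.of_list {G : MixedGraph V} {M S : Set V} (s t : Step V) (w : List (Step V))
    (hv : ∀ r ∈ s :: w, r.valid G) (hc : (s :: w).IsChain (Linked M S))
    (hl : (s :: w).getLast? = some t) : Walk G M S s.hs s.src t.tgt t.ht := by
  induction w generalizing s with
  | nil =>
    simp only [List.getLast?_singleton, Option.some.injEq] at hl
    subst hl
    exact .single (hv s (by simp))
  | cons r w ih =>
    rw [List.isChain_cons_cons] at hc
    have h := ih r (fun q hq => hv q (List.mem_cons_of_mem _ hq)) hc.2 (by simpa using hl)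
    have hs : Walk G M S s.hs s.src s.tgt s.ht := .single (hv s (by simp))
    rw [hc.1.1] at hs
    exact hs.trans h (by simpa [hc.1.1] using hc.1.2)

theorem exists_eq_append_of_not_nodup_map {α β : Type*} (f : α → β) (w : List α)
    (h : ¬ (w.map f).Nodup) :
    ∃ u s v t r, w = u ++ s :: (v ++ t :: r) ∧ f s = f t := by
  induction w with
  | nil => simp at h
  | cons s w ih =>
    by_cases hs : f s ∈ w.map f
    · obtain ⟨t, ht, hst⟩ := List.mem_map.1 hs
      obtain ⟨v, r, rfl⟩ := List.append_of_mem ht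
      exact ⟨[], s, v, t, r, rfl, hst.symm⟩
    · obtain ⟨u, s', v, t, r, rfl, h'⟩ := ih fun hw => h (by
        rw [List.map_cons, List.nodup_cons]; exact ⟨hs, hw⟩)
      exact ⟨s :: u, s', v, t, r, rfl, h'⟩

theorem exists_eq_append_of_not_isChain {α : Type*} {R : α → α → Prop} (w : List α)
    (h : ¬ w.IsChain R) : ∃ u a b v, w = u ++ a :: b :: v ∧ ¬ R a b := by
  by_contra! hc
  exact h (List.isChain_iff_forall_rel_of_append_cons_cons.2 fun a b u v hw => hc u a b v hw)

theorem src_mem_of_linked {M S : Set V} {i : V} {u v : List (Step V)} {s : Step V}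
    (hc : (u ++ s :: v).IsChain (Linked M S))
    (hh : (u ++ s :: v).head?.map Step.src = some i) : s.src ∈ i :: u.map Step.tgt := by
  rcases List.eq_nil_or_concat u with rfl | ⟨u, r, rfl⟩
  · simpa using hh
  · rw [List.concat_eq_append, List.append_assoc, List.singleton_append,
      List.isChain_append_cons_cons] at hc
    simp [hc.2.1.1]

/-- A list walk whose colliders lie in `tailSet G C` and which is not an m-connecting path
can be shortened. -/
theorem IsWalk.exists_shorter {G : MixedGraph V} (hG : G.IsRG) {M C : Set V} {i j : V}
    (hij : i ≠ j) {w : List (Step V)} (hw : IsWalk G M (tailSet G C) i j w)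
    (h : ¬ (IsPath G i j w ∧ MConnPath G M C w)) :
    ∃ w', w'.length < w.length ∧ IsWalk G M (tailSet G C) i j w' := by
  obtain ⟨hv, hc, hh, hl⟩ := hw
  by_cases hi : i ∈ w.map Step.tgt
  · obtain ⟨s, hs, hsi⟩ := List.mem_map.1 hi
    obtain ⟨u, v, rfl⟩ := List.append_of_mem hs
    cases v with
    | nil =>
      simp only [List.getLast?_append, List.getLast?_singleton, Option.some_or, Option.map_some,
        Option.some.injEq] at hl
      exact absurd (hsi.symm.trans hl) hij
    | cons t v =>
      rw [List.isChain_append_cons_cons] at hc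
      refine ⟨t :: v, by simp; omega, fun r hr => hv r ?_, hc.2.2, ?_, ?_⟩
      · simp only [List.mem_append, List.mem_cons] at hr ⊢
        tauto
      · simpa [hsi] using hc.2.1.1.symm
      · simpa [List.getLast?_append] using hl
  by_cases hn : (w.map Step.tgt).Nodup
  swap
  · obtain ⟨u, s, v, t, r, rfl, hst⟩ := exists_eq_append_of_not_nodup_map _ _ hn
    refine ⟨u ++ s :: r, by simp, fun q hq => hv q ?_, ?_, ?_, ?_⟩
    · simp only [List.mem_append, List.mem_cons] at hq ⊢
      tauto
    · rw [List.isChain_split] at hc ⊢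
      refine ⟨hc.1, ?_⟩
      obtain ⟨-, hc⟩ := hc
      cases r with
      | nil => simp
      | cons q r =>
        rw [← List.cons_append, List.isChain_append_cons_cons] at hc
        rw [List.isChain_cons_cons]
        refine ⟨⟨hst.trans hc.2.1.1, ?_⟩, hc.2.2⟩
        obtain ⟨p, v', hp⟩ : ∃ p v', v ++ [t] = p :: v' := by
          cases v with
          | nil => exact ⟨t, [], rfl⟩
          | cons p v => exact ⟨p, v ++ [t], rfl⟩
        have hc1 : (s :: p :: v').IsChain (Linked M (tailSet G C)) := by
          rw [← hp]; exact hc.1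
        rw [List.isChain_cons_cons] at hc1
        have hloop := Walk.of_list p t v' (fun q hq => hv q (by
          rw [← hp] at hq
          simp only [List.mem_append, List.mem_cons, List.mem_nil_iff, or_false] at hq ⊢
          tauto)) hc1.2 (by rw [← hp]; simp)
        rw [← hc1.1.1, ← hst] at hloop
        exact Join.of_loop hloop hc1.1.2 (by rw [hst]; exact hc.2.1.2)
    · cases u <;> simpa using hh
    · rw [← List.cons_append, ← List.append_assoc, List.getLast?_append] at hl
      cases r with
      | nil => simpa [hst] using hl
      | cons q r => simpa [List.getLast?_append] using hl
  have hpath : IsPath G i j w := by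
    refine ⟨?_, hv, hc.imp fun _ _ h => h.1, hh, hl, List.nodup_cons.2 ⟨hi, hn⟩⟩
    rintro rfl
    simp at hh
  obtain ⟨u, a, b, v, rfl, hab⟩ := exists_eq_append_of_not_isChain w fun h' => h ⟨hpath, h'⟩
  have hc' := hc
  rw [List.isChain_append_cons_cons] at hc'
  obtain ⟨hc1, ⟨hab1, hab2⟩, hc2⟩ := hc'
  have hcol : (a.ht = true ∧ b.hs = true) ∧ a.tgt ∉ C ∪ G.anSet C := by
    by_contra hcol
    refine hab ⟨fun h' => ?_, hab2.2⟩
    by_contra h''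
    exact hcol ⟨h', h''⟩
  obtain ⟨⟨hah, hbh⟩, hnC⟩ := hcol
  have hR : G.RibbonTail a.tgt := (hab2.1 ⟨hah, hbh⟩).resolve_left hnC
  have hea : Edge G a.hs a.src a.tgt true := by
    have := hv a (by simp)
    rw [← hah]; exact this
  have heb : Edge G true a.tgt b.tgt b.ht := by
    have := hv b (by simp)
    rw [← hbh, hab1]; exact this
  have hne : a.src ≠ b.tgt := by
    have h1 := src_mem_of_linked hc hh
    have h2 := List.nodup_cons.2 ⟨hi, hn⟩
    rw [List.map_append, List.map_cons, List.map_cons, ← List.cons_append,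
      List.nodup_append] at h2
    exact h2.2.2 _ h1 _ (by simp)
  have hedge : Edge G a.hs a.src b.tgt b.ht := by
    have hne1 := hea.ne hG.1.2.1
    have hne2 := heb.ne hG.1.2.1
    have hrib := hG.2
    by_contra hcon
    apply hrib
    generalize a.hs = p at *
    generalize b.ht = q at *
    cases p <;> cases q
    · exact ⟨a.src, a.tgt, b.tgt, hne1, hne2, hne, hR, Or.inr (Or.inl ⟨hea, heb, hcon⟩)⟩
    · exact ⟨a.src, a.tgt, b.tgt, hne1, hne2, hne, hR, Or.inr (Or.inr ⟨hea, heb, hcon⟩)⟩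
    · exact ⟨b.tgt, a.tgt, a.src, hne2.symm, hne1.symm, hne.symm, hR,
        Or.inr (Or.inr ⟨heb, hea.rev hG.1.1, hcon⟩)⟩
    · exact ⟨a.src, a.tgt, b.tgt, hne1, hne2, hne, hR, Or.inl ⟨hea, heb, hcon⟩⟩
  refine ⟨u ++ ⟨a.src, b.tgt, a.hs, b.ht⟩ :: v, by simp, ?_, ?_, ?_, ?_⟩
  · intro s hs
    simp only [List.mem_append, List.mem_cons] at hs
    rcases hs with hs | rfl | hs
    · exact hv s (by simp [hs])
    · exact hedge
    · exact hv s (by simp [hs])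
  · rw [List.isChain_split]
    constructor
    · rw [List.isChain_append] at hc1 ⊢
      refine ⟨hc1.1, by simp, fun x hx y hy => ?_⟩
      have := hc1.2.2 x hx a (by simp)
      simp only [List.head?_cons, Option.mem_def, Option.some.injEq] at hy
      subst hy
      exact this
    · rw [List.isChain_cons] at hc2 ⊢
      exact ⟨fun y hy => hc2.1 y hy, hc2.2⟩
  · cases u <;> simpa using hh
  · cases v with
    | nil => simpa [List.getLast?_append] using hl
    | cons q r => simpa [List.getLast?_append] using hl

theorem IsWalk.exists_mConnPath {G : MixedGraph V} (hG : G.IsRG) {M C : Set V} {i j : V}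
    (hij : i ≠ j) {w : List (Step V)} (hw : IsWalk G M (tailSet G C) i j w) :
    ∃ w', IsPath G i j w' ∧ MConnPath G M C w' := by
  by_cases h : IsPath G i j w ∧ MConnPath G M C w
  · exact ⟨w, h⟩
  · obtain ⟨w', hlt, hw'⟩ := hw.exists_shorter hG hij h
    exact hw'.exists_mConnPath hG hij
termination_by w.length

/-- In a ribbonless graph, m-connection by paths amounts to connection by walks whose
colliders may moreover be in ribbon tails. -/
theorem exists_mConnPath_iff {G : MixedGraph V} (hG : G.IsRG) {M C S : Set V} {i j : V}
    (hij : i ≠ j) (hS : C ∪ G.anSet C ⊆ S) (hS' : S ⊆ tailSet G C) :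
    (∃ w, IsPath G i j w ∧ MConnPath G M C w) ↔ ∃ a b, Walk G M S a i j b := by
  constructor
  · rintro ⟨w, ⟨hne, hv, hc, hh, hl, -⟩, hm⟩
    obtain ⟨s, w, rfl⟩ := List.exists_cons_of_ne_nil hne
    have hchain : (s :: w).IsChain (Linked M S) := by
      rw [List.isChain_iff_forall_rel_of_append_cons_cons]
      intro a b u v hw
      have h1 := List.isChain_iff_forall_rel_of_append_cons_cons.1 hc hw
      have h2 := List.isChain_iff_forall_rel_of_append_cons_cons.1 hm hw
      exact ⟨h1, fun h => hS (h2.1 h), h2.2⟩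
    obtain ⟨t, ht, rfl⟩ := Option.map_eq_some_iff.1 hl
    simp only [List.head?_cons, Option.map_some, Option.some.injEq] at hh
    subst hh
    exact ⟨_, _, Walk.of_list s t w hv hchain ht⟩
  · rintro ⟨a, b, h⟩
    obtain ⟨w, hw, -⟩ := (h.mono subset_rfl hS').exists_list
    exact hw.exists_mConnPath hG hij

/-! ### Marginalisation and conditioning -/

/-- The mark `a` at `x` after removal of the arrowheads at nodes of `S`. -/
def Dehead (S : Set V) (a : Bool) (x : V) (p : Bool) : Prop :=
  p = true ↔ a = true ∧ x ∉ S

theorem exists_dehead (S : Set V) (a : Bool) (x : V) : ∃ p, Dehead S a x p := by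
  classical
  exact ⟨decide (a = true ∧ x ∉ S), by simp [Dehead]⟩

/-- `x` and `y` are joined by a walk of `G` given `M` and `tailSet G C` whose endpoint marks,
with arrowheads at `tailSet G C` removed, are `p` and `q`. -/
def MargEdge (G : MixedGraph V) (M C : Set V) (p : Bool) (x y : V) (q : Bool) : Prop :=
  x ∈ G.nodes \ (M ∪ C) ∧ y ∈ G.nodes \ (M ∪ C) ∧ x ≠ y ∧
    ∃ a b, Walk G M (tailSet G C) a x y b ∧
      Dehead (tailSet G C) a x p ∧ Dehead (tailSet G C) b y q

/-- The graph on the nodes outside `M ∪ C` with an edge for every walk of `G` given `M` and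
`tailSet G C`, without arrowheads at `tailSet G C`. -/
def marg (G : MixedGraph V) (M C : Set V) : MixedGraph V where
  nodes := G.nodes \ (M ∪ C)
  arrow x y := MargEdge G M C false x y true
  arc x y := MargEdge G M C true x y true
  line x y := MargEdge G M C false x y false

section Marg

variable {G : MixedGraph V} {M C : Set V}

theorem MargEdge.rev (hG : G.Wf) {p q : Bool} {x y : V} (h : MargEdge G M C p x y q) :
    MargEdge G M C q y x p := by
  obtain ⟨hx, hy, hne, a, b, hw, ha, hb⟩ := h
  exact ⟨hy, hx, hne.symm, b, a, hw.rev hG, hb, ha⟩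

theorem edge_marg_iff (hG : G.Wf) {p q : Bool} {x y : V} :
    Edge (marg G M C) p x y q ↔ MargEdge G M C p x y q := by
  cases p <;> cases q
  · exact Iff.rfl
  · exact Iff.rfl
  · exact ⟨fun h => MargEdge.rev hG h, fun h => h.rev hG⟩
  · exact Iff.rfl

theorem anc_of_arrow_marg {x y : V} (h : (marg G M C).arrow x y) (hx : x ∉ tailSet G C) :
    G.anc x y ∧ y ∉ tailSet G C := by
  obtain ⟨-, -, -, a, b, hw, ha, hb⟩ := h
  have ha : a = false := by simpa [Dehead, hx] using ha
  exact ⟨((hw.tail ha).resolve_left hx).2, (hb.1 rfl).2⟩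

theorem anc_of_anc_marg {x y : V} (h : (marg G M C).anc x y) (hx : x ∉ tailSet G C) :
    G.anc x y ∧ y ∉ tailSet G C := by
  induction h with
  | single h => exact anc_of_arrow_marg h hx
  | tail _ h ih =>
    have h' := anc_of_arrow_marg h ih.2
    exact ⟨ih.1.trans h'.1, h'.2⟩

theorem lineEndpoint_marg {x : V} (h : (marg G M C).LineEndpoint x) : x ∈ tailSet G C := by
  obtain ⟨y, -, -, -, a, b, hw, ha, hb⟩ := h
  by_contra hx
  have ha : a = false := by simpa [Dehead, hx] using ha
  obtain ⟨rfl, hxy⟩ := (hw.tail ha).resolve_left hx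
  have hy : y ∈ tailSet G C := by simpa [Dehead] using hb
  exact hx (tailSet_closed hxy hy)

theorem mem_tailSet_of_ribbonTail_marg {x : V} (h : (marg G M C).RibbonTail x) :
    x ∈ tailSet G C := by
  by_contra hx
  obtain ⟨d, hd, h⟩ := h
  have hd : d ∉ tailSet G C := by
    rcases hd with rfl | hd
    · exact hx
    · exact (anc_of_anc_marg hd hx).2
  rcases h with h | h
  · exact hd (lineEndpoint_marg h)
  · exact hd (mem_tailSet_of_cycle (anc_of_anc_marg h hd).1)

theorem marg_isRG (hG : G.IsRG) : (marg G M C).IsRG := by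
  refine ⟨⟨⟨?_, ?_, ?_⟩, ?_, ?_⟩, ?_⟩
  · exact fun i j h => MargEdge.rev hG.1.1 h
  · exact fun i j h => MargEdge.rev hG.1.1 h
  · rintro i j (h | h | h)
    · exact ⟨h.1, h.2.1⟩
    · exact ⟨h.1, h.2.1⟩
    · exact ⟨h.1, h.2.1⟩
  · exact fun i => ⟨fun h => h.2.2.1 rfl, fun h => h.2.2.1 rfl, fun h => h.2.2.1 rfl⟩
  · exact hG.1.2.2.subset Set.sdiff_subset
  · rintro ⟨h, i, j, -, -, -, hi, hc⟩
    have hi := mem_tailSet_of_ribbonTail_marg hi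
    have key : ∀ p x, ¬ MargEdge G M C p x i true := by
      rintro p x ⟨-, -, -, a, b, -, -, hb⟩
      exact (hb.1 rfl).2 hi
    rcases hc with ⟨hc, -⟩ | ⟨hc, -⟩ | ⟨hc, -⟩ <;> exact key _ _ hc

/-- Walks of `marg G M C` expand to walks of `G`. -/
theorem Walk.of_marg (hG : G.Wf) {M' C' : Set V} {p q : Bool} {i y : V}
    (h : Walk (marg G M C) M' (C' ∪ (marg G M C).anSet C') p i y q) :
    ∃ a b, Walk G (M ∪ M') (tailSet G (C' ∪ C)) a i y b ∧ Dehead (tailSet G C) b y q := by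
  have expand : ∀ {a b : Bool} {x y : V}, Walk G M (tailSet G C) a x y b →
      Walk G (M ∪ M') (tailSet G (C' ∪ C)) a x y b := fun h =>
    h.mono Set.subset_union_left (tailSet_mono Set.subset_union_right)
  induction h with
  | single e =>
    obtain ⟨-, -, -, a, b, hw, -, hb⟩ := (edge_marg_iff hG).1 e
    exact ⟨a, b, expand hw, hb⟩
  | @snoc q c d i y z _ e hj ih =>
    obtain ⟨a, b, hw, hb⟩ := ih
    obtain ⟨-, -, -, a', b', hw', ha', hb'⟩ := (edge_marg_iff hG).1 e
    refine ⟨a, b', hw.trans (expand hw') ⟨?_, ?_⟩, hb'⟩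
    · rintro ⟨rfl, rfl⟩
      by_cases hy : y ∈ tailSet G C
      · exact tailSet_mono Set.subset_union_right hy
      · refine Or.inl ?_
        rcases hj.1 ⟨hb.2 ⟨rfl, hy⟩, ha'.2 ⟨rfl, hy⟩⟩ with h | ⟨c, hc, h⟩
        · exact Or.inl (Or.inl h)
        · exact Or.inr ⟨c, Or.inl hc, (anc_of_anc_marg h hy).1⟩
    · intro hn
      exact Or.inr (hj.2 fun hqc => hn ⟨(hb.1 hqc.1).1, (ha'.1 hqc.2).1⟩)

/-- Ancestry between nodes outside `M ∪ C` starting outside `tailSet G C` is preserved by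
`marg`. -/
theorem anc_marg_of_anc (hG : G.Wf) {x y : V} (hx : x ∈ G.nodes \ (M ∪ C))
    (hxS : x ∉ tailSet G C) (hy : y ∈ G.nodes \ (M ∪ C)) (h : G.anc x y) :
    x = y ∨ (marg G M C).anc x y := by
  have arrow_of : ∀ {z w : V}, z ∈ G.nodes \ (M ∪ C) → w ∈ G.nodes \ (M ∪ C) → G.anc x w →
      z ≠ w → Walk G M (tailSet G C) false z w true → (marg G M C).arrow z w :=
    fun hz hw hxw hne h => ⟨hz, hw, hne, false, true, h, by simp [Dehead],
      by simpa [Dehead] using fun hwS => hxS (tailSet_closed hxw hwS)⟩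
  have key : ∀ w, G.anc x w → ∃ z ∈ G.nodes \ (M ∪ C),
      (x = z ∨ (marg G M C).anc x z) ∧ Walk G M (tailSet G C) false z w true := by
    intro w hw
    induction hw with
    | single h => exact ⟨x, hx, Or.inl rfl, .single h⟩
    | @tail w w' hxw h ih =>
      obtain ⟨z, hz, hxz, hzw⟩ := ih
      have hwS : w ∉ tailSet G C := fun hwS => hxS (tailSet_closed hxw hwS)
      by_cases hwM : w ∈ M
      · exact ⟨z, hz, hxz, hzw.snoc (c := false) h ⟨by simp, fun _ => hwM⟩⟩
      · have hwO : w ∈ G.nodes \ (M ∪ C) := by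
          refine ⟨(hG.2.2 _ _ (Or.inl h)).1, ?_⟩
          rintro (hw | hw)
          · exact hwM hw
          · exact hwS (Or.inl (Or.inl hw))
        refine ⟨w, hwO, ?_, .single h⟩
        by_cases hzw' : z = w
        · exact hzw' ▸ hxz
        · have := arrow_of hz hwO hxw hzw' hzw
          rcases hxz with rfl | hxz
          · exact Or.inr (.single this)
          · exact Or.inr (hxz.tail this)
  obtain ⟨z, hz, hxz, hw⟩ := key y h
  by_cases hzy : z = y
  · exact hzy ▸ hxz
  · have := arrow_of hz hy h hzy hw
    rcases hxz with rfl | hxz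
    · exact Or.inr (.single this)
    · exact Or.inr (hxz.tail this)

/-- A node of `M` outside `tailSet G C` that is an ancestor of a node outside `M ∪ C` has a
descendant outside `M ∪ C`, on the way to that node, reachable through `M`. -/
theorem exists_walk_of_anc (hG : G.Wf) {k c : V} (hc : c ∈ G.nodes \ (M ∪ C))
    (hkM : k ∈ M) (hkS : k ∉ tailSet G C) (h : G.anc k c) :
    ∃ z ∈ G.nodes \ (M ∪ C), z ∉ tailSet G C ∧ (z = c ∨ G.anc z c) ∧
      Walk G M (tailSet G C) false k z true := by
  induction h using Relation.TransGen.head_induction_on with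
  | @single k h =>
    exact ⟨c, hc, fun hcS => hkS (tailSet_closed (.single h) hcS), Or.inl rfl, .single h⟩
  | @head k w h hwc ih =>
    have hwS : w ∉ tailSet G C := fun hwS => hkS (tailSet_closed (.single h) hwS)
    by_cases hwM : w ∈ M
    · obtain ⟨z, hz, hzS, hzc, hw⟩ := ih hwM hwS
      have hkw : Walk G M (tailSet G C) false k w true := .single h
      exact ⟨z, hz, hzS, hzc, hkw.trans hw ⟨by simp, fun _ => hwM⟩⟩
    · refine ⟨w, ⟨(hG.2.2 _ _ (Or.inl h)).2, ?_⟩, hwS, Or.inr hwc, .single h⟩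
      rintro (hw | hw)
      · exact hwM hw
      · exact hwS (Or.inl (Or.inl hw))

/-- Walks of `G` contract to walks of `marg G M C`. -/
theorem Walk.exists_marg (hG : G.Wf) {M' C' : Set V} (hM' : M' ⊆ G.nodes \ (M ∪ C))
    (hC' : C' ⊆ G.nodes \ (M ∪ C)) {a b : Bool} {i j : V} (hi : i ∈ G.nodes \ (M ∪ C))
    (hj : j ∈ G.nodes \ (M ∪ C)) (hij : i ≠ j)
    (h : Walk G (M ∪ M') ((C' ∪ C) ∪ G.anSet (C' ∪ C)) a i j b) :
    ∃ p q, Walk (marg G M C) M' (C' ∪ (marg G M C).anSet C') p i j q := by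
  set S := tailSet G C with hS
  set T := C' ∪ (marg G M C).anSet C' with hT
  have extend : ∀ {z y : V} {c b : Bool}, z ∈ G.nodes \ (M ∪ C) → y ∈ G.nodes \ (M ∪ C) →
      z ≠ y → Walk G M S c z y b → (z = i ∨ ∃ p d, Walk (marg G M C) M' T p i z d ∧
        ∀ c', Dehead S c z c' → Join M' T d z c') →
      ∃ p q, Walk (marg G M C) M' T p i y q ∧ Dehead S b y q := by
    intro z y c b hz hy hzy hw hpre
    obtain ⟨c', hc'⟩ := exists_dehead S c z
    obtain ⟨q, hq⟩ := exists_dehead S b y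
    have he : Edge (marg G M C) c' z y q :=
      (edge_marg_iff hG).2 ⟨hz, hy, hzy, c, b, hw, hc', hq⟩
    rcases hpre with rfl | ⟨p, d, hw', hj⟩
    · exact ⟨c', q, .single he, hq⟩
    · exact ⟨p, q, hw'.snoc he (hj c' hc'), hq⟩
  have key : ∃ z c, z ∈ G.nodes \ (M ∪ C) ∧ Walk G M S c z j b ∧
      (z = i ∨ ∃ p d, Walk (marg G M C) M' T p i z d ∧
        ∀ c', Dehead S c z c' → Join M' T d z c') := by
    clear hj hij
    induction h with
    | single e => exact ⟨_, _, hi, .single e, Or.inl rfl⟩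
    | @snoc b c' d i y y' _ e hj ih =>
      obtain ⟨z, c, hz, hw, hpre⟩ := ih hi extend
      by_cases hcut : Join M S b y c'
      · exact ⟨z, c, hz, hw.snoc e hcut, hpre⟩
      by_cases hcol : b = true ∧ c' = true
      · obtain ⟨rfl, rfl⟩ := hcol
        have hyS : y ∉ S := fun hy => hcut ⟨fun _ => hy, by simp⟩
        obtain ⟨k, hkO, hkS, hkC, hk, hk'⟩ : ∃ k ∈ G.nodes \ (M ∪ C), k ∉ S ∧
            (k ∈ C' ∪ G.anSet C') ∧ Walk G M S c z k true ∧ Walk G M S true k y' d := by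
          have hyC : y ∈ C' ∪ G.anSet C' := by
            rcases hj.1 ⟨rfl, rfl⟩ with (hy | hy) | ⟨c, hc | hc, hyc⟩
            · exact Or.inl hy
            · exact absurd (Or.inl (Or.inl hy)) hyS
            · exact Or.inr ⟨c, hc, hyc⟩
            · exact absurd (Or.inl (Or.inr ⟨c, hc, hyc⟩)) hyS
          by_cases hyM : y ∈ M
          · rcases hyC with hyC | ⟨c₀, hc₀, hyc₀⟩
            · exact absurd (Or.inl hyM) (hC' hyC).2
            · obtain ⟨k, hkO, hkS, hkc, hyk⟩ := exists_walk_of_anc hG (hC' hc₀) hyM hyS hyc₀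
              refine ⟨k, hkO, hkS, ?_, hw.trans hyk ⟨by simp, fun _ => hyM⟩,
                (hyk.rev hG).snoc e ⟨by simp, fun _ => hyM⟩⟩
              rcases hkc with rfl | hkc
              · exact Or.inl hc₀
              · exact Or.inr ⟨c₀, hc₀, hkc⟩
          · refine ⟨y, ⟨(e.mem_nodes hG).1, ?_⟩, hyS, hyC, hw, .single e⟩
            rintro (hy | hy)
            · exact hyM hy
            · exact hyS (Or.inl (Or.inl hy))
        have hkT : k ∈ T := by
          rcases hkC with hkC | ⟨c, hc, hkc⟩
          · exact Or.inl hkC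
          · rcases anc_marg_of_anc hG hkO hkS (hC' hc) hkc with rfl | h
            · exact Or.inl hc
            · exact Or.inr ⟨c, hc, h⟩
        refine ⟨k, true, hkO, hk', ?_⟩
        by_cases hzk : z = k
        · subst hzk
          refine hpre.imp_right ?_
          rintro ⟨p, d, hp, hjoin⟩
          refine ⟨p, d, hp, fun c' hc' => ⟨fun _ => hkT, fun hn => ?_⟩⟩
          obtain rfl : c' = true := hc'.2 ⟨rfl, hkS⟩
          obtain ⟨c'', hc''⟩ := exists_dehead S c z
          exact (hjoin c'' hc'').2 fun h' => hn ⟨h'.1, rfl⟩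
        · obtain ⟨p, q, hp, hq⟩ := extend hz hkO hzk hk hpre
          refine Or.inr ⟨p, q, hp, fun c' hc' => ⟨fun _ => hkT, fun hn => ?_⟩⟩
          exact absurd ⟨hq.2 ⟨rfl, hkS⟩, hc'.2 ⟨rfl, hkS⟩⟩ hn
      · have hyM : y ∈ M' := (hj.2 hcol).resolve_left fun hy =>
          hcut ⟨fun h => absurd h hcol, fun _ => hy⟩
        refine ⟨y, c', hM' hyM, .single e, ?_⟩
        by_cases hzy : z = y
        · subst hzy
          refine hpre.imp_right ?_
          rintro ⟨p, d, hp, hjoin⟩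
          refine ⟨p, d, hp, fun q hq => ⟨?_, fun _ => hyM⟩⟩
          rintro ⟨rfl, rfl⟩
          obtain ⟨rfl, hzS⟩ := hq.1 rfl
          obtain ⟨c'', hc''⟩ := exists_dehead S c z
          cases c
          · exact absurd hw.mem_of_tail_loop hzS
          · exact (hjoin c'' hc'').1 ⟨rfl, hc''.2 ⟨rfl, hzS⟩⟩
        · obtain ⟨p, q, hp, hq⟩ := extend hz (hM' hyM) hzy hw hpre
          refine Or.inr ⟨p, q, hp, fun r hr => ⟨?_, fun _ => hyM⟩⟩
          rintro ⟨rfl, rfl⟩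
          exact absurd ⟨(hq.1 rfl).1, (hr.1 rfl).1⟩ hcol
  obtain ⟨z, c, hz, hw, hpre⟩ := key
  by_cases hzj : z = j
  · subst hzj
    rcases hpre with rfl | ⟨p, d, hp, -⟩
    · exact absurd rfl hij
    · exact ⟨p, d, hp⟩
  · obtain ⟨p, q, hp, -⟩ := extend hz hj hzj hw hpre
    exact ⟨p, q, hp⟩

/-- `marg G M C` has the same m-connections as `G`, with `M` marginalised and `C`
conditioned. -/
theorem exists_mConnPath_marg_iff (hG : G.IsRG) {M' C' : Set V} (hM' : M' ⊆ G.nodes \ (M ∪ C))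
    (hC' : C' ⊆ G.nodes \ (M ∪ C)) {i j : V} (hi : i ∈ G.nodes \ (M ∪ C))
    (hj : j ∈ G.nodes \ (M ∪ C)) (hij : i ≠ j) :
    (∃ w, IsPath (marg G M C) i j w ∧ MConnPath (marg G M C) M' C' w) ↔
      ∃ w, IsPath G i j w ∧ MConnPath G (M ∪ M') (C' ∪ C) w := by
  rw [exists_mConnPath_iff (marg_isRG hG) hij subset_rfl fun x => Or.inl]
  constructor
  · rintro ⟨p, q, h⟩
    obtain ⟨a, b, h', -⟩ := h.of_marg hG.1.1
    exact (exists_mConnPath_iff hG hij (fun x => Or.inl) subset_rfl).2 ⟨a, b, h'⟩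
  · intro h
    obtain ⟨a, b, h'⟩ := (exists_mConnPath_iff hG hij subset_rfl fun x => Or.inl).1 h
    exact h'.exists_marg hG.1.1 hM' hC' hi hj hij

end Marg

theorem mSep_iff {G : MixedGraph V} {A B C : Set V} :
    MSep G A B C ↔ ∀ i ∈ A, ∀ j ∈ B,
      ¬ ∃ w, IsPath G i j w ∧ MConnPath G (G.nodes \ (A ∪ B ∪ C)) C w := by
  simp only [MSep, not_exists, not_and]

theorem mSep_marg_iff {G : MixedGraph V} (hG : G.IsRG) {M C A B D : Set V} (hM : M ⊆ G.nodes)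
    (hMC : Disjoint M C) (hA : A ⊆ G.nodes \ (M ∪ C)) (hB : B ⊆ G.nodes \ (M ∪ C))
    (hD : D ⊆ G.nodes \ (M ∪ C)) (hAB : Disjoint A B) :
    MSep (marg G M C) A B D ↔ MSep G A B (D ∪ C) := by
  have hM' : G.nodes \ (A ∪ B ∪ (D ∪ C)) = M ∪ (G.nodes \ (M ∪ C)) \ (A ∪ B ∪ D) := by
    ext x
    have h1 := @hM x
    have h2 : x ∈ M → x ∉ C := fun h => Set.disjoint_left.1 hMC h
    have h3 := @hA x
    have h4 := @hB x
    have h5 := @hD x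
    simp only [Set.mem_sdiff, Set.mem_union] at *
    tauto
  rw [mSep_iff, mSep_iff, hM']
  refine forall₂_congr fun i hi => forall₂_congr fun j hj => not_congr ?_
  exact exists_mConnPath_marg_iff hG Set.sdiff_subset hD (hA hi) (hB hj)
    (hAB.ne_of_mem hi hj)


/-- (Corollary 2) The class of ribbonless graphs is stable
under marginalisation and conditioning: for every ribbonless graph `G` and
disjoint subsets `M`, `C` of its node set there is a ribbonless graph `H`
with node set `V ∖ (M ∪ C)` inducing the marginal and conditional
independence model of `G`. -/
theorem stmt_6 {V : Type} (G : MixedGraph V) (M C : Set V)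
    (hG : G.IsRG) (hM : M ⊆ G.nodes) (hC : C ⊆ G.nodes) (hMC : Disjoint M C) :
    ∃ H : MixedGraph V, H.IsRG ∧ H.nodes = G.nodes \ (M ∪ C) ∧
      Jm H = alphaIM (Jm G) M C := by
  refine ⟨marg G M C, marg_isRG hG, rfl, Set.ext fun ⟨A, B, D⟩ => ?_⟩
  have hsub : ∀ X : Set V, X ⊆ G.nodes \ (M ∪ C) ↔ X ⊆ G.nodes ∧ Disjoint X (M ∪ C) :=
    fun X => Set.subset_sdiff
  constructor
  · rintro ⟨hA, hB, hD, hAB, hAD, hBD, h⟩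
    refine ⟨⟨((hsub A).1 hA).1, ((hsub B).1 hB).1, Set.union_subset ((hsub D).1 hD).1 hC, hAB,
      hAD.union_right (((hsub A).1 hA).2.mono_right Set.subset_union_right),
      hBD.union_right (((hsub B).1 hB).2.mono_right Set.subset_union_right),
      (mSep_marg_iff hG hM hMC hA hB hD hAB).1 h⟩, ?_⟩
    exact Set.disjoint_iff_inter_eq_empty.1
      ((((hsub A).1 hA).2.union_left ((hsub B).1 hB).2).union_left ((hsub D).1 hD).2)
  · rintro ⟨⟨hA, hB, hD, hAB, hAD, hBD, h⟩, hMC'⟩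
    have hMC' := Set.disjoint_iff_inter_eq_empty.2 hMC'
    simp only [Set.disjoint_union_left] at hMC'
    have hA' := (hsub A).2 ⟨hA, hMC'.1.1⟩
    have hB' := (hsub B).2 ⟨hB, hMC'.1.2⟩
    have hD' := (hsub D).2 ⟨Set.subset_union_left.trans hD, hMC'.2⟩
    exact ⟨hA', hB', hD', hAB, hAD.mono_right Set.subset_union_left,
      hBD.mono_right Set.subset_union_left, (mSep_marg_iff hG hM hMC hA' hB' hD' hAB).2 h⟩

end StableMixedGraphs
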